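/- arXiv:1707.06471 — 5 statements merged into one kernel-verified Lean document; each statement's English description precedes it below -/
import Mathlib

section
/- For all natural numbers m, n with m ≥ 16 and n ≥ 16, the grid graph G_{m,n} has a dominating set D with |D| = ⌊(m+2)(n+2)/5⌋ − 4. -/
/-- The m×n grid graph on vertex set `Fin m × Fin n`:
`(i,j)` and `(i',j')` are adjacent iff `|i−i'| + |j−j'| = 1`. -/
def gridGraph (m n : ℕ) : SimpleGraph (Fin m × Fin n) :=
  SimpleGraph.fromRel fun u v =>
    (u.1 = v.1 ∧ (u.2 : ℕ) + 1 = (v.2 : ℕ)) ∨ (u.2 = v.2 ∧ (u.1 : ℕ) + 1 = (v.1 : ℕ))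

/-- A set `D` of vertices is dominating if every vertex not in `D`
is adjacent to some vertex of `D`. -/
def IsDominatingSet {V : Type*} (G : SimpleGraph V) (D : Set V) : Prop :=
  ∀ v ∉ D, ∃ u ∈ D, G.Adj u v

namespace GridDomination

noncomputable section

/-- Two points of `ℤ × ℤ` are near if they are equal or adjacent. -/
def Near (u v : ℤ × ℤ) : Prop := |u.1 - v.1| + |u.2 - v.2| ≤ 1

instance (u v : ℤ × ℤ) : Decidable (Near u v) := inferInstanceAs (Decidable (_ ≤ _))

/-- The perfect code `x + 2 * y ≡ c [ZMOD 5]` of the integer grid. -/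
def Code (c : ℤ) (p : ℤ × ℤ) : Prop := (p.1 + 2 * p.2) % 5 = c % 5

instance (c : ℤ) (p : ℤ × ℤ) : Decidable (Code c p) := inferInstanceAs (Decidable (_ = _))

/-- The square at the corner of the quadrant. -/
def square : Finset (ℤ × ℤ) := Finset.Icc 0 4 ×ˢ Finset.Icc 0 4

/-- The points of the perfect code in `square`. -/
def cornerCode (c : ℤ) : Finset (ℤ × ℤ) := square.filter (Code (c % 5))

/-- Four points covering every point of the open quadrant that `cornerCode c` covers. -/
def patch (c : ℤ) : Finset (ℤ × ℤ) :=
  if c % 5 = 0 then {(1, 2), (2, 4), (3, 1), (4, 3)}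
  else if c % 5 = 1 then {(1, 2), (2, 2), (3, 4), (4, 1)}
  else if c % 5 = 2 then {(1, 1), (1, 3), (3, 2), (4, 4)}
  else if c % 5 = 3 then {(1, 3), (2, 1), (2, 3), (4, 2)}
  else {(1, 2), (1, 4), (3, 1), (3, 3)}

theorem emod_five_mem (c : ℤ) : c % 5 ∈ Finset.Icc (0 : ℤ) 4 := by
  rw [Finset.mem_Icc]; omega

theorem code_emod (c : ℤ) (p : ℤ × ℤ) : Code (c % 5) p ↔ Code c p := by
  simp [Code]

theorem patch_emod (c : ℤ) : patch (c % 5) = patch c := by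
  simp [patch]

theorem card_cornerCode (c : ℤ) : (cornerCode c).card = 5 := by
  have h : ∀ r ∈ Finset.Icc (0 : ℤ) 4, (square.filter (Code r)).card = 5 := by decide +kernel
  exact h _ (emod_five_mem c)

theorem card_patch_le (c : ℤ) : (patch c).card ≤ 4 := by
  have h : ∀ r ∈ Finset.Icc (0 : ℤ) 4, (patch r).card ≤ 4 := by decide +kernel
  rw [← patch_emod]
  exact h _ (emod_five_mem c)

theorem mem_cornerCode {c : ℤ} {p : ℤ × ℤ} :
    p ∈ cornerCode c ↔ ((0 ≤ p.1 ∧ p.1 ≤ 4) ∧ 0 ≤ p.2 ∧ p.2 ≤ 4) ∧ Code c p := by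
  simp [cornerCode, square, code_emod]

theorem exists_patch_near {c : ℤ} {p v : ℤ × ℤ} (hp : p ∈ cornerCode c) (hpv : Near p v)
    (h₁ : 1 ≤ v.1) (h₂ : 1 ≤ v.2) : ∃ u ∈ patch c, Near u v := by
  have key : ∀ r ∈ Finset.Icc (0 : ℤ) 4, ∀ p ∈ square.filter (Code r),
      ∀ v ∈ Finset.Icc (1 : ℤ) 5 ×ˢ Finset.Icc (1 : ℤ) 5, Near p v →
        ∃ u ∈ patch r, Near u v := by decide +kernel
  rw [← patch_emod]
  refine key _ (emod_five_mem c) p hp v ?_ hpv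
  rw [mem_cornerCode] at hp
  simp only [Near] at hpv
  simp only [Finset.mem_product, Finset.mem_Icc]
  grind

theorem exists_code_near (c : ℤ) (v : ℤ × ℤ) : ∃ p, Code c p ∧ Near p v := by
  obtain ⟨x, y⟩ := v
  have h : (x + 2 * y - c) % 5 = 0 ∨ (x + 2 * y - c) % 5 = 1 ∨ (x + 2 * y - c) % 5 = 2 ∨
      (x + 2 * y - c) % 5 = 3 ∨ (x + 2 * y - c) % 5 = 4 := by omega
  simp only [Code, Near]
  rcases h with h | h | h | h | h
  · exact ⟨(x, y), by dsimp only; omega, by simp⟩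
  · exact ⟨(x - 1, y), by dsimp only; omega, by simp⟩
  · exact ⟨(x, y - 1), by dsimp only; omega, by simp⟩
  · exact ⟨(x, y + 1), by dsimp only; omega, by simp⟩
  · exact ⟨(x + 1, y), by dsimp only; omega, by simp⟩

/-- The four rotations taking the quadrant to the corners of the rectangle `[0, M] × [0, N]`. -/
def rot (M N : ℤ) : Fin 4 → ℤ × ℤ → ℤ × ℤ
  | 0, p => p
  | 1, p => (M - p.2, p.1)
  | 2, p => (M - p.1, N - p.2)
  | 3, p => (p.2, N - p.1)

/-- The inverse of `rot`. -/
def unrot (M N : ℤ) : Fin 4 → ℤ × ℤ → ℤ × ℤ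
  | 0, p => p
  | 1, p => (p.2, M - p.1)
  | 2, p => (M - p.1, N - p.2)
  | 3, p => (N - p.2, p.1)

/-- The residue of the code with residue `c`, seen from a corner of the rectangle. -/
def rotResidue (M N c : ℤ) : Fin 4 → ℤ
  | 0 => c
  | 1 => 3 * (c - M)
  | 2 => M + 2 * N - c
  | 3 => 2 * c + N

variable {M N c : ℤ}

theorem unrot_rot (i : Fin 4) (p : ℤ × ℤ) : unrot M N i (rot M N i p) = p := by
  fin_cases i <;> simp [rot, unrot]

theorem rot_unrot (i : Fin 4) (p : ℤ × ℤ) : rot M N i (unrot M N i p) = p := by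
  fin_cases i <;> simp [rot, unrot]

theorem rot_injective (i : Fin 4) : Function.Injective (rot M N i) :=
  Function.LeftInverse.injective (unrot_rot i)

theorem code_rot (i : Fin 4) (p : ℤ × ℤ) :
    Code c (rot M N i p) ↔ Code (rotResidue M N c i) p := by
  fin_cases i <;> simp only [Code, rot, rotResidue] <;> omega

theorem near_rot (i : Fin 4) (p q : ℤ × ℤ) :
    Near (rot M N i p) (rot M N i q) ↔ Near p q := by
  fin_cases i <;> simp only [Near, rot] <;> grind

/-- The points of the code in the rectangle `[0, M] × [0, N]`. -/
def rectCode (M N c : ℤ) : Finset (ℤ × ℤ) :=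
  (Finset.Icc 0 M ×ˢ Finset.Icc 0 N).filter (Code c)

/-- The points of the code in the corners of the rectangle. -/
def corners (M N c : ℤ) : Finset (ℤ × ℤ) :=
  Finset.univ.biUnion fun i => (cornerCode (rotResidue M N c i)).image (rot M N i)

/-- The replacement for `corners`. -/
def patches (M N c : ℤ) : Finset (ℤ × ℤ) :=
  Finset.univ.biUnion fun i => (patch (rotResidue M N c i)).image (rot M N i)

theorem card_corners (hM : 10 ≤ M) (hN : 10 ≤ N) : (corners M N c).card = 20 := by
  rw [corners, Finset.card_biUnion]
  · simp [Finset.card_image_of_injective _ (rot_injective _), card_cornerCode]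
  · intro i _ j _ hij
    refine Finset.disjoint_left.2 fun x hi hj => ?_
    obtain ⟨p, hp, rfl⟩ := Finset.mem_image.1 hi
    obtain ⟨q, hq, h⟩ := Finset.mem_image.1 hj
    rw [mem_cornerCode] at hp hq
    fin_cases i <;> fin_cases j <;>
      first
      | exact hij rfl
      | (simp only [rot, Prod.ext_iff] at h; omega)

theorem card_patches_le : (patches M N c).card ≤ 16 := by
  refine (Finset.card_biUnion_le_card_mul _ _ 4 fun i _ => ?_).trans (by simp)
  exact Finset.card_image_le.trans (card_patch_le _)

theorem corners_subset (hM : 4 ≤ M) (hN : 4 ≤ N) : corners M N c ⊆ rectCode M N c := by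
  intro x hx
  obtain ⟨i, -, hx⟩ := Finset.mem_biUnion.1 hx
  obtain ⟨p, hp, rfl⟩ := Finset.mem_image.1 hx
  rw [mem_cornerCode] at hp
  refine Finset.mem_filter.2 ⟨?_, (code_rot i p).2 hp.2⟩
  rw [Finset.mem_product, Finset.mem_Icc, Finset.mem_Icc]
  fin_cases i <;> simp only [rot] <;> omega

/-- The code in the rectangle, with its corners replaced. -/
def patchedCode (M N c : ℤ) : Finset (ℤ × ℤ) :=
  (rectCode M N c \ corners M N c) ∪ patches M N c

theorem card_patchedCode_add_four_le (hM : 10 ≤ M) (hN : 10 ≤ N) :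
    (patchedCode M N c).card + 4 ≤ (rectCode M N c).card := by
  have hsub := corners_subset (c := c) (by omega : 4 ≤ M) (by omega : 4 ≤ N)
  have h₁ := Finset.card_union_le (rectCode M N c \ corners M N c) (patches M N c)
  have h₂ := Finset.card_sdiff_of_subset hsub
  have h₃ := Finset.card_le_card hsub
  have h₄ := card_corners (c := c) hM hN
  have h₅ := card_patches_le (M := M) (N := N) (c := c)
  simp only [patchedCode]
  omega

theorem exists_patchedCode_near {v : ℤ × ℤ} (hx : 0 < v.1) (hxM : v.1 < M)
    (hy : 0 < v.2) (hyN : v.2 < N) : ∃ u ∈ patchedCode M N c, Near u v := by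
  obtain ⟨p, hp, hpv⟩ := exists_code_near c v
  have hrect : p ∈ rectCode M N c := by
    refine Finset.mem_filter.2 ⟨?_, hp⟩
    simp only [Near] at hpv
    rw [Finset.mem_product, Finset.mem_Icc, Finset.mem_Icc]
    grind
  by_cases hc : p ∈ corners M N c
  · obtain ⟨i, -, hc⟩ := Finset.mem_biUnion.1 hc
    obtain ⟨q, hq, rfl⟩ := Finset.mem_image.1 hc
    have hqv : Near q (unrot M N i v) := by
      rwa [← near_rot (M := M) (N := N) i, rot_unrot]
    have hpos : 1 ≤ (unrot M N i v).1 ∧ 1 ≤ (unrot M N i v).2 := by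
      fin_cases i <;> simp only [unrot] <;> omega
    obtain ⟨u, hu, huv⟩ := exists_patch_near hq hqv hpos.1 hpos.2
    refine ⟨rot M N i u, Finset.mem_union_right _ ?_, ?_⟩
    · exact Finset.mem_biUnion.2 ⟨i, Finset.mem_univ _, Finset.mem_image_of_mem _ hu⟩
    · rwa [← near_rot (M := M) (N := N) i, rot_unrot] at huv
  · exact ⟨p, Finset.mem_union_left _ (Finset.mem_sdiff.2 ⟨hrect, hc⟩), hpv⟩

theorem exists_card_rectCode_le (m n : ℕ) :
    ∃ c, (rectCode (m + 1) (n + 1) c).card ≤ (m + 2) * (n + 2) / 5 := by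
  have hcard : (Finset.Icc (0 : ℤ) (m + 1) ×ˢ Finset.Icc (0 : ℤ) (n + 1)).card =
      (m + 2) * (n + 2) := by
    rw [Finset.card_product, Int.card_Icc, Int.card_Icc]
    congr 1
  obtain ⟨c, hc, h⟩ := Finset.exists_card_fiber_lt_of_card_lt_mul
    (s := Finset.Icc (0 : ℤ) (m + 1) ×ˢ Finset.Icc (0 : ℤ) (n + 1)) (t := Finset.Icc (0 : ℤ) 4)
    (f := fun p => (p.1 + 2 * p.2) % 5) (n := (m + 2) * (n + 2) / 5 + 1)
    (by rw [hcard, Int.card_Icc, show (4 + 1 - 0 : ℤ).toNat = 5 from rfl]; omega)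
  refine ⟨c, ?_⟩
  rw [Finset.mem_Icc] at hc
  have hmod : c % 5 = c := Int.emod_eq_of_lt hc.1 (by omega)
  have heq : rectCode (m + 1) (n + 1) c = (Finset.Icc (0 : ℤ) (m + 1) ×ˢ
      Finset.Icc (0 : ℤ) (n + 1)).filter fun p => (p.1 + 2 * p.2) % 5 = c := by
    ext p
    simp only [rectCode, Code, hmod, Finset.mem_filter]
  rw [heq]
  exact Nat.lt_succ_iff.1 h

/-- The coordinate in `Fin k` nearest to a given one, where `Fin k` sits in `ℤ` as `[1, k]`. -/
def clamp (k : ℕ) [NeZero k] (x : ℤ) : Fin k :=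
  ⟨min (x - 1).toNat (k - 1), by have := NeZero.pos k; omega⟩

theorem clamp_eq_or_adj {m n : ℕ} [NeZero m] [NeZero n] {u : ℤ × ℤ} {v : Fin m × Fin n}
    (h : Near u ((v.1 : ℤ) + 1, (v.2 : ℤ) + 1)) :
    (clamp m u.1, clamp n u.2) = v ∨ (gridGraph m n).Adj (clamp m u.1, clamp n u.2) v := by
  obtain ⟨x, y⟩ := u
  obtain ⟨⟨i, hi⟩, ⟨j, hj⟩⟩ := v
  rw [or_iff_not_imp_left]
  intro hne
  rw [gridGraph, SimpleGraph.fromRel_adj]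
  refine ⟨hne, ?_⟩
  simp only [Near] at h
  simp only [clamp, Prod.mk.injEq, Fin.mk.injEq] at hne ⊢
  have h' : (x = i + 1 ∧ y = j + 1) ∨ (x = i + 2 ∧ y = j + 1) ∨ (x = i ∧ y = j + 1) ∨
      (x = i + 1 ∧ y = j + 2) ∨ (x = i + 1 ∧ y = j) := by grind
  omega

end

end GridDomination

theorem grid_has_dominating_set_of_card (m n : ℕ) (hm : 16 ≤ m) (hn : 16 ≤ n) :
    ∃ D : Finset (Fin m × Fin n),
      IsDominatingSet (gridGraph m n) ↑D ∧ D.card = (m + 2) * (n + 2) / 5 - 4 := by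
  have : NeZero m := ⟨by omega⟩
  have : NeZero n := ⟨by omega⟩
  obtain ⟨c, hc⟩ := GridDomination.exists_card_rectCode_le m n
  have hcard := GridDomination.card_patchedCode_add_four_le (M := m + 1) (N := n + 1) (c := c)
    (by omega) (by omega)
  let S := (GridDomination.patchedCode (m + 1) (n + 1) c).image fun u =>
    (GridDomination.clamp m u.1, GridDomination.clamp n u.2)
  have hS : S.card ≤ (m + 2) * (n + 2) / 5 - 4 := by
    have : S.card ≤ _ := Finset.card_image_le
    omega
  have hle : (m + 2) * (n + 2) / 5 - 4 ≤ Fintype.card (Fin m × Fin n) := by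
    have : (m + 2) * (n + 2) ≤ 5 * (m * n) := by nlinarith
    rw [Fintype.card_prod, Fintype.card_fin, Fintype.card_fin]
    omega
  obtain ⟨D, hSD, hD⟩ := Finset.exists_superset_card_eq hS hle
  refine ⟨D, fun v hv => ?_, hD⟩
  obtain ⟨u, hu, huv⟩ := GridDomination.exists_patchedCode_near (M := m + 1) (N := n + 1) (c := c)
    (v := ((v.1 : ℤ) + 1, (v.2 : ℤ) + 1)) (by dsimp only; omega) (by dsimp only; omega)
    (by dsimp only; omega) (by dsimp only; omega)
  have hmem := hSD (Finset.mem_image_of_mem _ hu)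
  rcases GridDomination.clamp_eq_or_adj huv with h | h
  · exact absurd (h ▸ hmem) hv
  · exact ⟨_, hmem, h⟩
end

section
/- For all natural numbers m, n with m ≥ 16 and n ≥ 16, there exists a set D of vertices of the grid graph G_{m,n} with |D| = ⌊(m+2)(n+2)/5⌋ − 4 such that every vertex not in D has at least one and at most two neighbors in D. -/
namespace GridDomination

/-- The perfect code `x + 2y + s ≡ 0 (mod 5)` of the integer lattice. -/
def latticeCode (s x y : ℕ) : Bool := (x + 2 * y + s) % 5 == 0

/-- The vertices chosen in the `4 × 4` block at a corner of the grid, where `t` is the residue for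
which the perfect code continues this block as `p + 2q + t ≡ 0 (mod 5)`. -/
def cornerBlock : ℕ → List (ℕ × ℕ)
  | 0 => [(0, 2), (1, 0), (1, 2), (3, 1)]
  | 1 => [(0, 0), (0, 2), (2, 1), (3, 3)]
  | 2 => [(0, 1), (1, 1), (2, 3), (3, 0)]
  | 3 => [(0, 1), (1, 3), (2, 0), (3, 2)]
  | _ => [(0, 1), (0, 3), (2, 0), (2, 2)]

/-- The translate of the perfect code that is used in a grid with `m` rows. -/
def codeShift (m : ℕ) : ℕ := if m % 5 = 1 ∨ m % 5 = 4 then 2 else 1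

/-- The perfect code in the `(m + 2) × (n + 2)` grid, with the vertices of the outer boundary
moved to their neighbours in the `m × n` grid. -/
def projectedCode (m n i j : ℕ) : Bool :=
  latticeCode (codeShift m) (i + 1) (j + 1) ||
    (i == 0 && latticeCode (codeShift m) 0 (j + 1)) ||
    (i + 1 == m && latticeCode (codeShift m) (m + 1) (j + 1)) ||
    (j == 0 && latticeCode (codeShift m) (i + 1) 0) ||
    (j + 1 == n && latticeCode (codeShift m) (i + 1) (n + 1))

/-- The dominating set: the projected perfect code, with each of the four corner blocks
(up to rotation) replaced by `cornerBlock`. -/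
def chosen (m n i j : ℕ) : Bool :=
  decide (i < m) && decide (j < n) &&
    if i < 4 then
      if j < 4 then (cornerBlock ((codeShift m + 3) % 5)).contains (i, j)
      else if n ≤ j + 4 then
        (cornerBlock ((4 * n + 2 * codeShift m + 2) % 5)).contains (n - 1 - j, i)
      else projectedCode m n i j
    else if m ≤ i + 4 then
      if j < 4 then
        (cornerBlock ((3 * m + 3 * codeShift m + 1) % 5)).contains (j, m - 1 - i)
      else if n ≤ j + 4 then
        (cornerBlock ((4 * m + 3 * n + 4 * codeShift m) % 5)).contains (m - 1 - i, n - 1 - j)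
      else projectedCode m n i j
    else projectedCode m n i j

/-- The number of chosen neighbours of a vertex that is not chosen. (When `i = 0`, the truncated
difference `i - 1` gives back the vertex itself, which does not count.) -/
def chosenNeighbors (m n i j : ℕ) : ℕ :=
  (chosen m n (i - 1) j).toNat + (chosen m n (i + 1) j).toNat +
    (chosen m n i (j - 1)).toNat + (chosen m n i (j + 1)).toNat

/-- A vertex is chosen or has one or two chosen neighbours. -/
def wellDominated (m n i j : ℕ) : Bool :=
  chosen m n i j || chosenNeighbors m n i j == 1 || chosenNeighbors m n i j == 2

def chosenCount (m n : ℕ) : ℕ :=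
  ∑ i ∈ Finset.range m, ∑ j ∈ Finset.range n, (chosen m n i j).toNat

def IsGood (m n : ℕ) : Prop :=
  (∀ i < m, ∀ j < n, wellDominated m n i j = true) ∧
    chosenCount m n = (m + 2) * (n + 2) / 5 - 4

instance (m n : ℕ) : Decidable (IsGood m n) := inferInstanceAs (Decidable (_ ∧ _))

theorem isGood_of_lt : ∀ m < 21, 16 ≤ m → ∀ n < 21, 16 ≤ n → IsGood m n := by
  decide +kernel

theorem codeShift_add_five (m : ℕ) : codeShift (m + 5) = codeShift m := by
  simp [codeShift]

theorem latticeCode_congr {s x y x' y' : ℕ} (hx : x % 5 = x' % 5) (hy : y % 5 = y' % 5) :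
    latticeCode s x y = latticeCode s x' y' := by
  have h : (x + 2 * y + s) % 5 = (x' + 2 * y' + s) % 5 := by omega
  simp [latticeCode, h]

theorem projectedCode_add_rows {m n i j i' : ℕ} (h : i' % 5 = i % 5) (h₀ : i' = 0 ↔ i = 0)
    (h₁ : i' + 1 = m + 5 ↔ i + 1 = m) :
    projectedCode (m + 5) n i' j = projectedCode m n i j := by
  have e₀ : (i' == 0) = (i == 0) := by rw [Bool.eq_iff_iff]; simpa using h₀
  have e₁ : (i' + 1 == m + 5) = (i + 1 == m) := by
    rw [Bool.eq_iff_iff, beq_iff_eq, beq_iff_eq]; exact h₁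
  unfold projectedCode
  rw [codeShift_add_five, e₀, e₁,
    latticeCode_congr (x := i' + 1) (x' := i + 1) (by omega) (rfl : (j + 1) % 5 = _),
    latticeCode_congr (x := m + 5 + 1) (x' := m + 1) (by omega) (rfl : (j + 1) % 5 = _),
    latticeCode_congr (x := i' + 1) (x' := i + 1) (by omega) (rfl : 0 % 5 = _),
    latticeCode_congr (x := i' + 1) (x' := i + 1) (by omega) (rfl : (n + 1) % 5 = _)]

theorem projectedCode_add_columns {m n i j j' : ℕ} (h : j' % 5 = j % 5) (h₀ : j' = 0 ↔ j = 0)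
    (h₁ : j' + 1 = n + 5 ↔ j + 1 = n) :
    projectedCode m (n + 5) i j' = projectedCode m n i j := by
  have e₀ : (j' == 0) = (j == 0) := by rw [Bool.eq_iff_iff]; simpa using h₀
  have e₁ : (j' + 1 == n + 5) = (j + 1 == n) := by
    rw [Bool.eq_iff_iff, beq_iff_eq, beq_iff_eq]; exact h₁
  unfold projectedCode
  rw [e₀, e₁,
    latticeCode_congr (y := j' + 1) (y' := j + 1) (rfl : (i + 1) % 5 = _) (by omega),
    latticeCode_congr (y := j' + 1) (y' := j + 1) (rfl : 0 % 5 = _) (by omega),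
    latticeCode_congr (y := j' + 1) (y' := j + 1) (rfl : (m + 1) % 5 = _) (by omega),
    latticeCode_congr (y := n + 5 + 1) (y' := n + 1) (rfl : (i + 1) % 5 = _) (by omega)]

theorem chosen_add_five_left {m n i j : ℕ} (hi : i + 4 < m) :
    chosen (m + 5) n i j = chosen m n i j := by
  have hp : projectedCode (m + 5) n i j = projectedCode m n i j :=
    projectedCode_add_rows rfl Iff.rfl (by omega)
  have h₁ : i < m + 5 := by omega
  have h₂ : i < m := by omega
  have h₃ : ¬ m + 5 ≤ i + 4 := by omega
  have h₄ : ¬ m ≤ i + 4 := by omega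
  simp only [chosen, codeShift_add_five, hp, h₁, h₂, h₃, h₄, reduceIte]

theorem chosen_add_five_add_five_left {m n i j : ℕ} (hi : 4 ≤ i) :
    chosen (m + 5) n (i + 5) j = chosen m n i j := by
  have e₁ : (3 * (m + 5) + 3 * codeShift m + 1) % 5 = (3 * m + 3 * codeShift m + 1) % 5 := by omega
  have e₂ : (4 * (m + 5) + 3 * n + 4 * codeShift m) % 5 = (4 * m + 3 * n + 4 * codeShift m) % 5 := by
    omega
  have hp : projectedCode (m + 5) n (i + 5) j = projectedCode m n i j :=
    projectedCode_add_rows (by omega) (by omega) (by omega)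
  have h₁ : i + 5 < m + 5 ↔ i < m := by omega
  have h₂ : ¬ i + 5 < 4 := by omega
  have h₃ : ¬ i < 4 := by omega
  have h₄ : m + 5 ≤ i + 5 + 4 ↔ m ≤ i + 4 := by omega
  have h₅ : m + 5 - 1 - (i + 5) = m - 1 - i := by omega
  simp only [chosen, codeShift_add_five, hp, h₁, h₂, h₃, h₄, h₅, e₁, e₂, reduceIte]

theorem chosen_add_five_right {m n i j : ℕ} (hj : j + 4 < n) :
    chosen m (n + 5) i j = chosen m n i j := by
  have hp : projectedCode m (n + 5) i j = projectedCode m n i j :=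
    projectedCode_add_columns rfl Iff.rfl (by omega)
  have h₁ : j < n + 5 := by omega
  have h₂ : j < n := by omega
  have h₃ : ¬ n + 5 ≤ j + 4 := by omega
  have h₄ : ¬ n ≤ j + 4 := by omega
  simp only [chosen, hp, h₁, h₂, h₃, h₄, reduceIte]

theorem chosen_add_five_add_five_right {m n i j : ℕ} (hj : 4 ≤ j) :
    chosen m (n + 5) i (j + 5) = chosen m n i j := by
  have e₁ : (4 * (n + 5) + 2 * codeShift m + 2) % 5 = (4 * n + 2 * codeShift m + 2) % 5 := by omega
  have e₂ : (4 * m + 3 * (n + 5) + 4 * codeShift m) % 5 = (4 * m + 3 * n + 4 * codeShift m) % 5 := by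
    omega
  have hp : projectedCode m (n + 5) i (j + 5) = projectedCode m n i j :=
    projectedCode_add_columns (by omega) (by omega) (by omega)
  have h₁ : j + 5 < n + 5 ↔ j < n := by omega
  have h₂ : ¬ j + 5 < 4 := by omega
  have h₃ : ¬ j < 4 := by omega
  have h₄ : n + 5 ≤ j + 5 + 4 ↔ n ≤ j + 4 := by omega
  have h₅ : n + 5 - 1 - (j + 5) = n - 1 - j := by omega
  simp only [chosen, hp, h₁, h₂, h₃, h₄, h₅, e₁, e₂, reduceIte]

theorem wellDominated_add_five_left {m n i j : ℕ} (hm : 16 ≤ m) (hi : i < m + 5) :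
    ∃ i' < m, wellDominated (m + 5) n i j = wellDominated m n i' j := by
  by_cases h : i ≤ 10
  · refine ⟨i, by omega, ?_⟩
    simp only [wellDominated, chosenNeighbors]
    rw [chosen_add_five_left (by omega), chosen_add_five_left (by omega),
      chosen_add_five_left (by omega), chosen_add_five_left (by omega),
      chosen_add_five_left (by omega)]
  · obtain ⟨k, rfl⟩ : ∃ k, i = k + 5 := ⟨i - 5, by omega⟩
    refine ⟨k, by omega, ?_⟩
    simp only [wellDominated, chosenNeighbors]
    rw [show k + 5 - 1 = k - 1 + 5 by omega, show k + 5 + 1 = k + 1 + 5 by omega]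
    rw [chosen_add_five_add_five_left (by omega), chosen_add_five_add_five_left (by omega),
      chosen_add_five_add_five_left (by omega), chosen_add_five_add_five_left (by omega),
      chosen_add_five_add_five_left (by omega)]

theorem wellDominated_add_five_right {m n i j : ℕ} (hn : 16 ≤ n) (hj : j < n + 5) :
    ∃ j' < n, wellDominated m (n + 5) i j = wellDominated m n i j' := by
  by_cases h : j ≤ 10
  · refine ⟨j, by omega, ?_⟩
    simp only [wellDominated, chosenNeighbors]
    rw [chosen_add_five_right (by omega), chosen_add_five_right (by omega),
      chosen_add_five_right (by omega), chosen_add_five_right (by omega),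
      chosen_add_five_right (by omega)]
  · obtain ⟨k, rfl⟩ : ∃ k, j = k + 5 := ⟨j - 5, by omega⟩
    refine ⟨k, by omega, ?_⟩
    simp only [wellDominated, chosenNeighbors]
    rw [show k + 5 - 1 = k - 1 + 5 by omega, show k + 5 + 1 = k + 1 + 5 by omega]
    rw [chosen_add_five_add_five_right (by omega), chosen_add_five_add_five_right (by omega),
      chosen_add_five_add_five_right (by omega), chosen_add_five_add_five_right (by omega),
      chosen_add_five_add_five_right (by omega)]

theorem sum_range_insert_five {m : ℕ} {f g : ℕ → ℕ} (hm : 4 ≤ m) (hlt : ∀ i < 4, g i = f i)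
    (hge : ∀ i, 4 ≤ i → g (i + 5) = f i) :
    ∑ i ∈ Finset.range (m + 5), g i =
      ∑ i ∈ Finset.range m, f i + ∑ k ∈ Finset.range 5, g (k + 4) := by
  obtain ⟨l, rfl⟩ := Nat.exists_eq_add_of_le hm
  have h : ∑ x ∈ Finset.range l, g (4 + 5 + x) = ∑ x ∈ Finset.range l, f (4 + x) :=
    Finset.sum_congr rfl fun x _ => by rw [← hge _ (by omega)]; congr 1; omega
  have h' : ∑ i ∈ Finset.range 4, g i = ∑ i ∈ Finset.range 4, f i :=
    Finset.sum_congr rfl fun i hi => hlt i (Finset.mem_range.1 hi)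
  rw [show 4 + l + 5 = 4 + 5 + l by omega, Finset.sum_range_add, Finset.sum_range_add,
    Finset.sum_range_add, h, h']
  simp only [add_comm 4]
  omega

theorem sum_range_one_add_ends {n : ℕ} (hn : 0 < n) :
    ∑ j ∈ Finset.range n, (1 + (if j = 0 then 1 else 0) + if j + 1 = n then 1 else 0) = n + 2 := by
  obtain ⟨k, rfl⟩ := Nat.exists_eq_add_of_lt hn
  simp [Finset.sum_add_distrib]

theorem sum_latticeCode_five_rows (s y : ℕ) :
    ∑ k ∈ Finset.range 5, (latticeCode s (k + 4 + 1) y).toNat = 1 := by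
  simp only [Finset.sum_range_succ, Finset.sum_range_zero, latticeCode, Bool.toNat,
    Bool.cond_eq_ite, beq_iff_eq]
  split_ifs <;> omega

theorem sum_latticeCode_five_columns (s x : ℕ) :
    ∑ k ∈ Finset.range 5, (latticeCode s x (k + 4 + 1)).toNat = 1 := by
  simp only [Finset.sum_range_succ, Finset.sum_range_zero, latticeCode, Bool.toNat,
    Bool.cond_eq_ite, beq_iff_eq]
  split_ifs <;> omega

theorem toNat_chosen_of_row {m n i j : ℕ} (hn : 2 ≤ n) (h₁ : 4 ≤ i) (h₂ : i + 4 < m)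
    (hj : j < n) :
    (chosen m n i j).toNat = (latticeCode (codeShift m) (i + 1) (j + 1)).toNat +
      (if j = 0 then (latticeCode (codeShift m) (i + 1) 0).toNat else 0) +
      if j + 1 = n then (latticeCode (codeShift m) (i + 1) (n + 1)).toNat else 0 := by
  have a₁ : i < m := by omega
  have a₂ : ¬ i < 4 := by omega
  have a₃ : ¬ m ≤ i + 4 := by omega
  have a₄ : i ≠ 0 := by omega
  have a₅ : i + 1 ≠ m := by omega
  simp only [chosen, projectedCode, latticeCode, a₁, a₂, a₃, hj, beq_eq_false_iff_ne.2 a₄,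
    beq_eq_false_iff_ne.2 a₅, Bool.toNat, Bool.cond_eq_ite, Bool.or_eq_true, Bool.and_eq_true,
    beq_iff_eq, Bool.false_and, Bool.or_false, decide_true, Bool.true_and, reduceIte]
  generalize codeShift m = s
  split_ifs <;> omega

theorem toNat_chosen_of_column {m n i j : ℕ} (hm : 2 ≤ m) (h₁ : 4 ≤ j) (h₂ : j + 4 < n)
    (hi : i < m) :
    (chosen m n i j).toNat = (latticeCode (codeShift m) (i + 1) (j + 1)).toNat +
      (if i = 0 then (latticeCode (codeShift m) 0 (j + 1)).toNat else 0) +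
      if i + 1 = m then (latticeCode (codeShift m) (m + 1) (j + 1)).toNat else 0 := by
  have a₁ : j < n := by omega
  have a₂ : ¬ j < 4 := by omega
  have a₃ : ¬ n ≤ j + 4 := by omega
  have a₄ : j ≠ 0 := by omega
  have a₅ : j + 1 ≠ n := by omega
  simp only [chosen, projectedCode, latticeCode, a₁, a₂, a₃, hi, beq_eq_false_iff_ne.2 a₄,
    beq_eq_false_iff_ne.2 a₅, Bool.toNat, Bool.cond_eq_ite, Bool.or_eq_true, Bool.and_eq_true,
    beq_iff_eq, Bool.false_and, Bool.or_false, decide_true, Bool.true_and, reduceIte, ite_self]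
  generalize codeShift m = s
  split_ifs <;> omega

theorem sum_chosen_five_rows {m n j : ℕ} (hm : 16 ≤ m) (hn : 16 ≤ n) (hj : j < n) :
    ∑ k ∈ Finset.range 5, (chosen m n (k + 4) j).toNat =
      1 + (if j = 0 then 1 else 0) + if j + 1 = n then 1 else 0 := by
  rw [Finset.sum_congr rfl fun k hk => by
    have := Finset.mem_range.1 hk
    exact toNat_chosen_of_row (i := k + 4) (by omega) (by omega) (by omega : k + 4 + 4 < m) hj]
  simp only [Finset.sum_add_distrib, sum_latticeCode_five_rows]
  split_ifs <;> simp [sum_latticeCode_five_rows]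

theorem sum_chosen_five_columns {m n i : ℕ} (hm : 16 ≤ m) (hn : 16 ≤ n) (hi : i < m) :
    ∑ k ∈ Finset.range 5, (chosen m n i (k + 4)).toNat =
      1 + (if i = 0 then 1 else 0) + if i + 1 = m then 1 else 0 := by
  rw [Finset.sum_congr rfl fun k hk => by
    have := Finset.mem_range.1 hk
    exact toNat_chosen_of_column (j := k + 4) (by omega) (by omega) (by omega : k + 4 + 4 < n) hi]
  simp only [Finset.sum_add_distrib, sum_latticeCode_five_columns]
  split_ifs <;> simp [sum_latticeCode_five_columns]

theorem chosenCount_add_five_left {m n : ℕ} (hm : 16 ≤ m) (hn : 16 ≤ n) :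
    chosenCount (m + 5) n = chosenCount m n + (n + 2) := by
  unfold chosenCount
  rw [sum_range_insert_five (f := fun i => ∑ j ∈ Finset.range n, (chosen m n i j).toNat) (by omega)
    (fun i hi => by simp only [chosen_add_five_left (show i + 4 < m by omega)])
    (fun i hi => by simp only [chosen_add_five_add_five_left hi]), Finset.sum_comm (s := Finset.range 5),
    Finset.sum_congr rfl fun j hj =>
      sum_chosen_five_rows (by omega : 16 ≤ m + 5) hn (Finset.mem_range.1 hj),
    sum_range_one_add_ends (by omega)]

theorem chosenCount_add_five_right {m n : ℕ} (hm : 16 ≤ m) (hn : 16 ≤ n) :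
    chosenCount m (n + 5) = chosenCount m n + (m + 2) := by
  unfold chosenCount
  rw [Finset.sum_congr rfl fun i _ =>
    sum_range_insert_five (f := fun j => (chosen m n i j).toNat) (by omega : 4 ≤ n)
      (fun j hj => by rw [chosen_add_five_right (by omega)])
      (fun j hj => by rw [chosen_add_five_add_five_right hj]), Finset.sum_add_distrib,
    Finset.sum_congr rfl fun i hi =>
      sum_chosen_five_columns hm (by omega : 16 ≤ n + 5) (Finset.mem_range.1 hi),
    sum_range_one_add_ends (by omega)]

theorem IsGood.add_five_left {m n : ℕ} (hm : 16 ≤ m) (hn : 16 ≤ n) (h : IsGood m n) :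
    IsGood (m + 5) n := by
  refine ⟨fun i hi j hj => ?_, ?_⟩
  · obtain ⟨i', hi', e⟩ := wellDominated_add_five_left (n := n) (j := j) hm hi
    rw [e, h.1 i' hi' j hj]
  · have : 18 * 18 ≤ (m + 2) * (n + 2) := Nat.mul_le_mul (by omega) (by omega)
    rw [chosenCount_add_five_left hm hn, h.2,
      show (m + 5 + 2) * (n + 2) = (m + 2) * (n + 2) + 5 * (n + 2) by ring]
    omega

theorem IsGood.add_five_right {m n : ℕ} (hm : 16 ≤ m) (hn : 16 ≤ n) (h : IsGood m n) :
    IsGood m (n + 5) := by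
  refine ⟨fun i hi j hj => ?_, ?_⟩
  · obtain ⟨j', hj', e⟩ := wellDominated_add_five_right (m := m) (i := i) hn hj
    rw [e, h.1 i hi j' hj']
  · have : 18 * 18 ≤ (m + 2) * (n + 2) := Nat.mul_le_mul (by omega) (by omega)
    rw [chosenCount_add_five_right hm hn, h.2,
      show (m + 2) * (n + 5 + 2) = (m + 2) * (n + 2) + 5 * (m + 2) by ring]
    omega

theorem isGood {m n : ℕ} (hm : 16 ≤ m) (hn : 16 ≤ n) : IsGood m n := by
  induction m using Nat.strong_induction_on with
  | _ m ihm =>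
    by_cases h : m < 21
    · clear ihm
      induction n using Nat.strong_induction_on with
      | _ n ihn =>
        by_cases h' : n < 21
        · exact isGood_of_lt m h hm n h' hn
        · obtain ⟨k, rfl⟩ : ∃ k, n = k + 5 := ⟨n - 5, by omega⟩
          exact (ihn k (by omega) (by omega)).add_five_right hm (by omega)
    · obtain ⟨k, rfl⟩ : ∃ k, m = k + 5 := ⟨m - 5, by omega⟩
      exact (ihm k (by omega) (by omega)).add_five_left (by omega) hn

theorem gridGraph_adj {m n : ℕ} {u v : Fin m × Fin n} :
    (gridGraph m n).Adj u v ↔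
      ((u.1 : ℕ) = v.1 ∧ ((u.2 : ℕ) + 1 = v.2 ∨ (v.2 : ℕ) + 1 = u.2)) ∨
        ((u.2 : ℕ) = v.2 ∧ ((u.1 : ℕ) + 1 = v.1 ∨ (v.1 : ℕ) + 1 = u.1)) := by
  obtain ⟨⟨a, ha⟩, ⟨b, hb⟩⟩ := u
  obtain ⟨⟨c, hc⟩, ⟨d, hd⟩⟩ := v
  simp only [gridGraph, SimpleGraph.fromRel_adj, ne_eq, Prod.mk.injEq, Fin.mk.injEq]
  omega

theorem lt_of_chosen {m n i j : ℕ} (h : chosen m n i j = true) : i < m ∧ j < n := by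
  simp only [chosen, Bool.and_eq_true, decide_eq_true_eq] at h
  exact h.1

/-- The chosen vertices of the grid. -/
def chosenSet (m n : ℕ) : Finset (Fin m × Fin n) :=
  Finset.univ.filter fun v => chosen m n v.1 v.2 = true

theorem mem_chosenSet {m n : ℕ} {v : Fin m × Fin n} :
    v ∈ chosenSet m n ↔ chosen m n v.1 v.2 = true := by
  simp [chosenSet]

theorem card_chosenSet (m n : ℕ) : (chosenSet m n).card = chosenCount m n := by
  rw [chosenSet, Finset.card_filter, Fintype.sum_prod_type, chosenCount,
    ← Fin.sum_univ_eq_sum_range (fun i => ∑ j ∈ Finset.range n, (chosen m n i j).toNat)]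
  refine Finset.sum_congr rfl fun i _ => ?_
  rw [← Fin.sum_univ_eq_sum_range (fun j => (chosen m n i j).toNat)]
  refine Finset.sum_congr rfl fun j _ => ?_
  cases chosen m n i j <;> rfl

theorem ncard_neighbors_le (m n : ℕ) (v : Fin m × Fin n) :
    {u | u ∈ chosenSet m n ∧ (gridGraph m n).Adj u v}.ncard ≤ chosenNeighbors m n v.1 v.2 := by
  let single (i j : ℕ) : Finset (ℕ × ℕ) := if chosen m n i j then {(i, j)} else ∅
  have hsingle (i j : ℕ) : (single i j).card = (chosen m n i j).toNat := by
    cases h : chosen m n i j <;> simp [single, h]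
  let toNat : Fin m × Fin n → ℕ × ℕ := fun u => (u.1, u.2)
  have hinj : toNat.Injective := fun u w h => by
    simp only [toNat, Prod.mk.injEq, Fin.val_inj] at h
    exact Prod.ext h.1 h.2
  rw [← Set.ncard_image_of_injective _ hinj]
  calc
    _ ≤ (↑(single (v.1 - 1) v.2 ∪ single (v.1 + 1) v.2 ∪ single v.1 (v.2 - 1) ∪
          single v.1 (v.2 + 1)) : Set (ℕ × ℕ)).ncard := by
      refine Set.ncard_le_ncard ?_ (Finset.finite_toSet _)
      rintro _ ⟨u, ⟨hu, huv⟩, rfl⟩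
      rw [mem_chosenSet] at hu
      have hmem (i j : ℕ) (hi : (u.1 : ℕ) = i) (hj : (u.2 : ℕ) = j) : toNat u ∈ single i j := by
        subst hi hj
        simp [single, hu, toNat]
      simp only [Finset.coe_union, Set.mem_union, Finset.mem_coe]
      rcases gridGraph_adj.1 huv with ⟨h, h' | h'⟩ | ⟨h, h' | h'⟩
      · exact .inl (.inr (hmem _ _ h (by omega)))
      · exact .inr (hmem _ _ h (by omega))
      · exact .inl (.inl (.inl (hmem _ _ (by omega) h)))
      · exact .inl (.inl (.inr (hmem _ _ (by omega) h)))
    _ ≤ _ := by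
      rw [Set.ncard_coe_finset, chosenNeighbors, ← hsingle, ← hsingle, ← hsingle, ← hsingle]
      exact (Finset.card_union_le _ _).trans <| Nat.add_le_add_right
        ((Finset.card_union_le _ _).trans <| Nat.add_le_add_right (Finset.card_union_le _ _) _) _

theorem one_le_ncard_neighbors {m n : ℕ} {v : Fin m × Fin n} (hv : v ∉ chosenSet m n)
    (h : chosenNeighbors m n v.1 v.2 ≠ 0) :
    1 ≤ {u | u ∈ chosenSet m n ∧ (gridGraph m n).Adj u v}.ncard := by
  rw [Nat.one_le_iff_ne_zero, ne_eq, Set.ncard_eq_zero, ← ne_eq, ← Set.nonempty_iff_ne_empty]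
  have key (i j : ℕ) (hij : chosen m n i j = true)
      (hadj : (i = v.1 ∧ (j + 1 = v.2 ∨ (v.2 : ℕ) + 1 = j)) ∨
        (j = v.2 ∧ (i + 1 = v.1 ∨ (v.1 : ℕ) + 1 = i))) :
      {u | u ∈ chosenSet m n ∧ (gridGraph m n).Adj u v}.Nonempty :=
    ⟨(⟨i, (lt_of_chosen hij).1⟩, ⟨j, (lt_of_chosen hij).2⟩), mem_chosenSet.2 hij,
      gridGraph_adj.2 hadj⟩
  rw [mem_chosenSet] at hv
  have hpred_row (hc : chosen m n (v.1 - 1) v.2 = true) : (v.1 : ℕ) ≠ 0 := fun h0 =>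
    hv (by simpa [h0] using hc)
  have hpred_col (hc : chosen m n v.1 (v.2 - 1) = true) : (v.2 : ℕ) ≠ 0 := fun h0 =>
    hv (by simpa [h0] using hc)
  by_contra hne
  refine h ?_
  simp only [chosenNeighbors, Nat.add_eq_zero_iff, Bool.toNat_eq_zero]
  simp only [← Bool.not_eq_true]
  refine ⟨⟨⟨fun hc => ?_, fun hc => ?_⟩, fun hc => ?_⟩, fun hc => ?_⟩
  · have := hpred_row hc
    exact hne (key _ _ hc (by omega))
  · exact hne (key _ _ hc (by omega))
  · have := hpred_col hc
    exact hne (key _ _ hc (by omega))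
  · exact hne (key _ _ hc (by omega))

end GridDomination

theorem grid_has_onetwo_set_of_card (m n : ℕ) (hm : 16 ≤ m) (hn : 16 ≤ n) :
    ∃ D : Finset (Fin m × Fin n),
      D.card = (m + 2) * (n + 2) / 5 - 4 ∧
      ∀ v ∉ D, 1 ≤ {u | u ∈ D ∧ (gridGraph m n).Adj u v}.ncard ∧
        {u | u ∈ D ∧ (gridGraph m n).Adj u v}.ncard ≤ 2 := by
  have hgood := GridDomination.isGood hm hn
  refine ⟨GridDomination.chosenSet m n, (GridDomination.card_chosenSet m n).trans hgood.2,
    fun v hv => ?_⟩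
  have hwell := hgood.1 v.1 v.1.isLt v.2 v.2.isLt
  have hv' := hv
  rw [GridDomination.mem_chosenSet] at hv'
  simp only [GridDomination.wellDominated, Bool.or_eq_true, beq_iff_eq, or_assoc] at hwell
  have hwell := hwell.resolve_left hv'
  have hle := GridDomination.ncard_neighbors_le m n v
  exact ⟨GridDomination.one_le_ncard_neighbors hv (by omega), by omega⟩
end

section
/- For all natural numbers m, n with m ≥ 16 and n ≥ 16, the [1,2]-domination number of the grid graph satisfies γ_{[1,2]}(G_{m,n}) ≤ ⌊(m+2)(n+2)/5⌋ − 4. -/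
/-- A `[1,2]`-set: every vertex not in `D` has at least one and at most two
neighbors in `D`. -/
def Is12Set {V : Type*} (G : SimpleGraph V) (D : Set V) : Prop :=
  ∀ v ∉ D, 1 ≤ {u | u ∈ D ∧ G.Adj u v}.ncard ∧ {u | u ∈ D ∧ G.Adj u v}.ncard ≤ 2

/-- The `[1,2]`-domination number: the minimum cardinality of a `[1,2]`-set. -/
noncomputable def onetwoDominationNumber {V : Type*} [Fintype V] (G : SimpleGraph V) : ℕ :=
  sInf {k | ∃ D : Finset V, Is12Set G ↑D ∧ D.card = k}

/-- The number of marked cells among the four neighbors of the cell `(i + 1, j + 1)`. -/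
def markedNeighbors (f : ℕ → ℕ → Bool) (i j : ℕ) : ℕ :=
  (f i (j + 1)).toNat + (f (i + 2) (j + 1)).toNat + (f (i + 1) j).toNat + (f (i + 1) (j + 2)).toNat

/-- A marking `f` of the cells `{1,…,m} × {1,…,n}` (with an unmarked border) that is a `[1,2]`-set
of the size required by the bound, and in which rows `6,…,10` and columns `6,…,10` can be repeated
without destroying these properties. -/
structure IsExtendablePattern (m n : ℕ) (f : ℕ → ℕ → Bool) : Prop where
  border_rows : ∀ j < n + 2, f 0 j = false ∧ f (m + 1) j = false
  border_cols : ∀ i < m + 2, f i 0 = false ∧ f i (n + 1) = false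
  dominated : ∀ i < m, ∀ j < n, f (i + 1) (j + 1) = true ∨
    1 ≤ markedNeighbors f i j ∧ markedNeighbors f i j ≤ 2
  rows_periodic : ∀ j < n + 2, f 5 j = f 10 j ∧ f 6 j = f 11 j
  cols_periodic : ∀ i < m + 2, f i 5 = f i 10 ∧ f i 6 = f i 11
  card_le : ∑ i ∈ Finset.range (m + 2), ∑ j ∈ Finset.range (n + 2), (f i j).toNat ≤
    (m + 2) * (n + 2) / 5 - 4
  card_rows : ∑ i ∈ Finset.range 5, ∑ j ∈ Finset.range (n + 2), (f (6 + i) j).toNat = n + 2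
  card_cols : ∑ i ∈ Finset.range (m + 2), ∑ j ∈ Finset.range 5, (f i (6 + j)).toNat = m + 2
  card_block : ∑ i ∈ Finset.range 5, ∑ j ∈ Finset.range 5, (f (6 + i) (6 + j)).toNat = 5

theorem IsExtendablePattern.swap {m n : ℕ} {f : ℕ → ℕ → Bool} (h : IsExtendablePattern m n f) :
    IsExtendablePattern n m (fun i j => f j i) where
  border_rows := h.border_cols
  border_cols := h.border_rows
  dominated i hi j hj := by
    refine (h.dominated j hj i hi).imp_right fun h => ?_
    simp only [markedNeighbors] at h ⊢
    omega
  rows_periodic := h.cols_periodic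
  cols_periodic := h.rows_periodic
  card_le := by rw [Finset.sum_comm, mul_comm]; exact h.card_le
  card_rows := by rw [Finset.sum_comm]; exact h.card_cols
  card_cols := by rw [Finset.sum_comm]; exact h.card_rows
  card_block := by rw [Finset.sum_comm]; exact h.card_block

/-- The map of row indices that repeats the rows `6,…,10`. -/
def repeatBand (i : ℕ) : ℕ := if i < 11 then i else i - 5

theorem repeatBand_of_lt {i : ℕ} (h : i < 11) : repeatBand i = i := if_pos h

theorem repeatBand_add_five {i : ℕ} (h : 6 ≤ i) : repeatBand (i + 5) = i := by
  rw [repeatBand, if_neg (by omega), Nat.add_sub_cancel]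

theorem sum_range_repeatBand (g : ℕ → ℕ) (k : ℕ) :
    ∑ i ∈ Finset.range (11 + k + 5), g (repeatBand i) =
      ∑ i ∈ Finset.range (11 + k), g i + ∑ i ∈ Finset.range 5, g (6 + i) := by
  induction k with
  | zero =>
    simp [Finset.sum_range_succ, repeatBand]
    ring
  | succ k ih =>
    rw [show 11 + (k + 1) + 5 = 11 + k + 5 + 1 by ring, Finset.sum_range_succ, ih,
      repeatBand_add_five (by omega), ← Nat.add_assoc 11 k 1, Finset.sum_range_succ _ (11 + k)]
    exact add_right_comm _ _ _

theorem IsExtendablePattern.repeatRows {m n : ℕ} {f : ℕ → ℕ → Bool} (hm : 16 ≤ m) (hn : 16 ≤ n)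
    (h : IsExtendablePattern m n f) :
    IsExtendablePattern (m + 5) n (fun i j => f (repeatBand i) j) where
  border_rows j hj := by
    rw [show m + 5 + 1 = (m + 1) + 5 by ring, repeatBand_add_five (by omega)]
    exact h.border_rows j hj
  border_cols i hi := h.border_cols _ (by rw [repeatBand]; split_ifs <;> omega)
  dominated i hi j hj := by
    have h₁ := h.rows_periodic (j + 1) (by omega)
    rcases lt_or_ge i 10 with hi' | hi'
    · have := h.dominated i (by omega) j hj
      have e : f (repeatBand (i + 2)) (j + 1) = f (i + 2) (j + 1) := by
        rcases eq_or_ne i 9 with rfl | h9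
        · exact h₁.2
        · rw [repeatBand_of_lt (by omega)]
      simpa only [markedNeighbors, e, repeatBand_of_lt (show i < 11 by omega),
        repeatBand_of_lt (show i + 1 < 11 by omega)] using this
    · obtain ⟨i, rfl⟩ := Nat.exists_eq_add_of_le' (show 5 ≤ i by omega)
      have := h.dominated i (by omega) j hj
      have e : f (repeatBand (i + 5)) (j + 1) = f i (j + 1) := by
        rcases eq_or_ne i 5 with rfl | h5
        · exact h₁.1.symm
        · rw [repeatBand_add_five (by omega)]
      simpa only [markedNeighbors, e, Nat.add_right_comm i 5,
        repeatBand_add_five (show 6 ≤ i + 1 by omega),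
        repeatBand_add_five (show 6 ≤ i + 2 by omega)] using this
  rows_periodic j hj := ⟨(h.rows_periodic j hj).1, rfl⟩
  cols_periodic i hi := h.cols_periodic _ (by rw [repeatBand]; split_ifs <;> omega)
  card_le := by
    obtain ⟨k, rfl⟩ := Nat.exists_eq_add_of_le (show 9 ≤ m by omega)
    have := sum_range_repeatBand (fun i => ∑ j ∈ Finset.range (n + 2), (f i j).toNat) k
    have h₁ := h.card_le
    rw [show 9 + k + 2 = 11 + k by ring] at h₁
    rw [show 9 + k + 5 + 2 = 11 + k + 5 by ring, this, h.card_rows, add_mul,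
      Nat.add_mul_div_left _ _ (by norm_num)]
    have : 16 * 16 ≤ (11 + k) * (n + 2) := Nat.mul_le_mul (by omega) (by omega)
    omega
  card_rows := h.card_rows
  card_cols := by
    obtain ⟨k, rfl⟩ := Nat.exists_eq_add_of_le (show 9 ≤ m by omega)
    have := sum_range_repeatBand (fun i => ∑ j ∈ Finset.range 5, (f i (6 + j)).toNat) k
    have h₁ := h.card_cols
    rw [show 9 + k + 2 = 11 + k by ring] at h₁
    rw [show 9 + k + 5 + 2 = 11 + k + 5 by ring, this, h.card_block, h₁]
  card_block := h.card_block

/-- The optimal marking of a `4 × 4` corner next to the perfect code `i + 2 * j ≡ r [MOD 5]`. -/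
def cornerPatch (r i j : ℕ) : Bool :=
  match r % 5 with
  | 0 => [(1, 2), (2, 4), (3, 1), (4, 3)].contains (i, j)
  | 1 => [(1, 2), (2, 2), (3, 4), (4, 1)].contains (i, j)
  | 2 => [(1, 1), (1, 3), (3, 2), (4, 4)].contains (i, j)
  | 3 => [(1, 3), (2, 1), (2, 3), (4, 2)].contains (i, j)
  | _ => [(1, 2), (1, 4), (3, 1), (3, 3)].contains (i, j)

/-- Membership in the perfect code of residue `c` in the square lattice. -/
def latticeCode (c i j : ℕ) : Bool := (i + 2 * j) % 5 == c

/-- The perfect code of residue `c`, with the code cells just outside the `m × n` rectangle moved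
inside, and with the four corners replaced by corner patches. -/
def patchedCode (m n c i j : ℕ) : Bool :=
  if i = 0 ∨ m < i ∨ j = 0 ∨ n < j then false
  else if i ≤ 4 ∧ j ≤ 4 then cornerPatch c i j
  else if i ≤ 4 ∧ n < j + 4 then cornerPatch (2 * c + (n + 1)) (n + 1 - j) i
  else if m < i + 4 ∧ j ≤ 4 then cornerPatch (3 * c + 2 * (m + 1)) j (m + 1 - i)
  else if m < i + 4 ∧ n < j + 4 then
    cornerPatch (4 * c + (m + 1) + 2 * (n + 1)) (m + 1 - i) (n + 1 - j)
  else latticeCode c i j || (i == 1 && latticeCode c 0 j) || (i == m && latticeCode c (m + 1) j) ||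
    (j == 1 && latticeCode c i 0) || (j == n && latticeCode c i (n + 1))

/-- A residue for which the perfect code has few cells in the `m × n` rectangle. -/
def sparseResidue (m n : ℕ) : ℕ :=
  if (m, n) ∈ [(16, 16), (19, 16), (19, 17)] then 3 else 4

theorem isExtendablePattern_patchedCode {m n : ℕ} (hm : 16 ≤ m) (hm' : m ≤ 20) (hn : 16 ≤ n)
    (hn' : n ≤ 20) : IsExtendablePattern m n (patchedCode m n (sparseResidue m n)) := by
  interval_cases m <;> interval_cases n <;>
    exact ⟨by decide +kernel, by decide +kernel, by decide +kernel, by decide +kernel,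
      by decide +kernel, by decide +kernel, by decide +kernel, by decide +kernel,
      by decide +kernel⟩

theorem exists_isExtendablePattern_of_rows_le {m n : ℕ} (hm : 16 ≤ m) (hm' : m ≤ 20)
    (hn : 16 ≤ n) : ∃ f, IsExtendablePattern m n f := by
  induction n using Nat.strong_induction_on with
  | _ n ih =>
    rcases le_or_gt n 20 with hn' | hn'
    · exact ⟨_, isExtendablePattern_patchedCode hm hm' hn hn'⟩
    · obtain ⟨k, rfl⟩ := Nat.exists_eq_add_of_le' (show 5 ≤ n by omega)
      obtain ⟨f, hf⟩ := ih k (by omega) (by omega)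
      exact ⟨_, (hf.swap.repeatRows (by omega) hm).swap⟩

theorem exists_isExtendablePattern {m n : ℕ} (hm : 16 ≤ m) (hn : 16 ≤ n) :
    ∃ f, IsExtendablePattern m n f := by
  induction m using Nat.strong_induction_on with
  | _ m ih =>
    rcases le_or_gt m 20 with hm' | hm'
    · exact exists_isExtendablePattern_of_rows_le hm hm' hn
    · obtain ⟨k, rfl⟩ := Nat.exists_eq_add_of_le' (show 5 ≤ m by omega)
      obtain ⟨f, hf⟩ := ih k (by omega) (by omega)
      exact ⟨_, hf.repeatRows (by omega) hn⟩

theorem ncard_marked_adj_gridGraph {m n : ℕ} {f : ℕ → ℕ → Bool}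
    (hr : ∀ j < n + 2, f 0 j = false ∧ f (m + 1) j = false)
    (hc : ∀ i < m + 2, f i 0 = false ∧ f i (n + 1) = false) (v : Fin m × Fin n) :
    {u : Fin m × Fin n | f (u.1 + 1) (u.2 + 1) = true ∧ (gridGraph m n).Adj u v}.ncard =
      markedNeighbors f v.1 v.2 := by
  obtain ⟨⟨i, hi⟩, ⟨j, hj⟩⟩ := v
  let φ : Fin m × Fin n → ℕ × ℕ := fun u => (u.1 + 1, u.2 + 1)
  have hφ : Function.Injective φ := by
    rintro ⟨a, b⟩ ⟨c, d⟩ h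
    simpa [φ, Fin.ext_iff] using h
  let s : Finset (ℕ × ℕ) := {(i, j + 1), (i + 2, j + 1), (i + 1, j), (i + 1, j + 2)}
  have himage : φ '' {u : Fin m × Fin n | f (u.1 + 1) (u.2 + 1) = true ∧
      (gridGraph m n).Adj u (⟨i, hi⟩, ⟨j, hj⟩)} = ↑(s.filter fun p => f p.1 p.2 = true) := by
    ext ⟨a, b⟩
    simp only [φ, s, gridGraph, SimpleGraph.fromRel_adj, Set.mem_image, Set.mem_ofPred_eq,
      Prod.exists, Prod.mk.injEq, Finset.coe_filter, Finset.mem_insert, Finset.mem_singleton,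
      Fin.ext_iff, ne_eq]
    constructor
    · rintro ⟨x, y, ⟨hf, -, h⟩, rfl, rfl⟩
      exact ⟨by omega, hf⟩
    · rintro ⟨h, hf⟩
      have ha : a ≠ 0 := by rintro rfl; simp [(hr b (by omega)).1] at hf
      have ha' : a ≠ m + 1 := by rintro rfl; simp [(hr b (by omega)).2] at hf
      have hb : b ≠ 0 := by rintro rfl; simp [(hc a (by omega)).1] at hf
      have hb' : b ≠ n + 1 := by rintro rfl; simp [(hc a (by omega)).2] at hf
      obtain ⟨a, rfl⟩ := Nat.exists_eq_succ_of_ne_zero ha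
      obtain ⟨b, rfl⟩ := Nat.exists_eq_succ_of_ne_zero hb
      exact ⟨⟨a, by omega⟩, ⟨b, by omega⟩, ⟨hf, by simp only; omega, by simp only; omega⟩, rfl, rfl⟩
  rw [← Set.ncard_image_of_injective _ hφ, himage, Set.ncard_coe_finset, Finset.card_filter]
  simp only [s]
  rw [Finset.sum_insert (by simp), Finset.sum_insert (by simp), Finset.sum_insert (by simp),
    Finset.sum_singleton]
  simp only [markedNeighbors, Bool.toNat, Bool.cond_eq_ite, add_assoc]

theorem card_marked_le (m n : ℕ) (f : ℕ → ℕ → Bool) :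
    (Finset.univ.filter fun v : Fin m × Fin n => f (v.1 + 1) (v.2 + 1) = true).card ≤
      ∑ i ∈ Finset.range (m + 2), ∑ j ∈ Finset.range (n + 2), (f i j).toNat := by
  have shrink (g : ℕ → ℕ) (k : ℕ) :
      ∑ i : Fin k, g (i + 1) ≤ ∑ i ∈ Finset.range (k + 2), g i := by
    rw [Fin.sum_univ_eq_sum_range (fun i => g (i + 1)), Finset.sum_range_succ,
      Finset.sum_range_succ']
    omega
  rw [Finset.card_filter, Fintype.sum_prod_type]
  refine le_trans (Finset.sum_le_sum fun i _ => ?_)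
    (shrink (fun i => ∑ j ∈ Finset.range (n + 2), (f i j).toNat) m)
  simpa only [Bool.toNat, Bool.cond_eq_ite] using shrink (fun j => (f (i + 1) j).toNat) n

theorem grid_onetwo_domination_number_le (m n : ℕ) (hm : 16 ≤ m) (hn : 16 ≤ n) :
    onetwoDominationNumber (gridGraph m n) ≤ (m + 2) * (n + 2) / 5 - 4 := by
  obtain ⟨f, hf⟩ := exists_isExtendablePattern hm hn
  refine le_trans (Nat.sInf_le ⟨Finset.univ.filter fun v : Fin m × Fin n =>
    f (v.1 + 1) (v.2 + 1) = true, fun v hv => ?_, rfl⟩)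
    ((card_marked_le m n f).trans hf.card_le)
  simp only [Finset.coe_filter, Finset.mem_univ, true_and, Set.mem_ofPred_eq] at hv ⊢
  rw [ncard_marked_adj_gridGraph hf.border_rows hf.border_cols]
  exact (hf.dominated v.1 v.1.2 v.2 v.2.2).resolve_left hv
end

section
/- For every integer c and any two distinct vertices u, v of the infinite grid graph on ℤ² that both lie in the set D_c = {(i,j) ∈ ℤ × ℤ : j ≡ 3i + c (mod 5)}, the closed neighborhoods of u and v are disjoint. -/
/-- The infinite grid graph on `ℤ × ℤ`:
`(i,j)` and `(i',j')` are adjacent iff `|i−i'| + |j−j'| = 1`. -/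
def intGridGraph : SimpleGraph (ℤ × ℤ) :=
  SimpleGraph.fromRel fun u v =>
    (u.1 = v.1 ∧ u.2 + 1 = v.2) ∨ (u.2 = v.2 ∧ u.1 + 1 = v.1)

/-- The diagonal set `D_c = {(i,j) : j ≡ 3i + c (mod 5)}`. -/
def diagSet (c : ℤ) : Set (ℤ × ℤ) := {p | p.2 ≡ 3 * p.1 + c [ZMOD 5]}

theorem mem_closedNeighborhood_intGridGraph {u w : ℤ × ℤ}
    (h : w ∈ insert u (intGridGraph.neighborSet u)) :
    (w.1 = u.1 ∧ (w.2 = u.2 ∨ w.2 = u.2 + 1 ∨ w.2 = u.2 - 1)) ∨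
      (w.2 = u.2 ∧ (w.1 = u.1 + 1 ∨ w.1 = u.1 - 1)) := by
  rcases h with rfl | h
  · simp
  · simp only [SimpleGraph.mem_neighborSet, intGridGraph, SimpleGraph.fromRel_adj] at h
    omega

theorem diagSet_closed_neighborhoods_disjoint (c : ℤ) (u v : ℤ × ℤ)
    (hu : u ∈ diagSet c) (hv : v ∈ diagSet c) (huv : u ≠ v) :
    Disjoint (insert u (intGridGraph.neighborSet u))
      (insert v (intGridGraph.neighborSet v)) := by
  rw [Set.disjoint_left]
  intro w hwu hwv
  have h₁ := mem_closedNeighborhood_intGridGraph hwu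
  have h₂ := mem_closedNeighborhood_intGridGraph hwv
  simp only [diagSet, Set.mem_ofPred_eq, Int.ModEq] at hu hv
  have hne : ¬(u.1 = v.1 ∧ u.2 = v.2) := fun h => huv (Prod.ext h.1 h.2)
  omega
end

section
/- Let m, n be natural numbers with m ≥ 3 and n ≥ 3, let c be an integer, and let D = {(i,j) ∈ {1,…,m}×{1,…,n} : j ≡ 3i + c (mod 5)}. Then every vertex (i,j) of the grid graph G_{m,n} with 2 ≤ i ≤ m−1 and 2 ≤ j ≤ n−1 has exactly one element of D in its closed neighborhood. -/
theorem eq_or_gridGraph_adj_iff {m n : ℕ} (v u : Fin m × Fin n) :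
    (u = v ∨ (gridGraph m n).Adj v u) ↔
      ((u.1 : ℕ) = v.1 ∧ ((u.2 : ℕ) = v.2 ∨ (u.2 : ℕ) + 1 = v.2 ∨ (u.2 : ℕ) = v.2 + 1)) ∨
      ((u.2 : ℕ) = v.2 ∧ ((u.1 : ℕ) + 1 = v.1 ∨ (u.1 : ℕ) = v.1 + 1)) := by
  simp only [gridGraph, SimpleGraph.fromRel_adj, ne_eq, Prod.ext_iff, Fin.ext_iff]
  omega

theorem grid_diag_efficiently_dominates_interior (m n : ℕ) (hm : 3 ≤ m) (hn : 3 ≤ n)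
    (c : ℤ) (v : Fin m × Fin n)
    (hi₁ : 2 ≤ (v.1 : ℕ) + 1) (hi₂ : (v.1 : ℕ) + 1 ≤ m - 1)
    (hj₁ : 2 ≤ (v.2 : ℕ) + 1) (hj₂ : (v.2 : ℕ) + 1 ≤ n - 1) :
    ∃! u : Fin m × Fin n,
      (((u.2 : ℕ) : ℤ) + 1 ≡ 3 * (((u.1 : ℕ) : ℤ) + 1) + c [ZMOD 5] ∧
        (u = v ∨ (gridGraph m n).Adj v u)) := by
  simp only [eq_or_gridGraph_adj_iff, Int.ModEq]
  obtain ⟨⟨i, hi⟩, ⟨j, hj⟩⟩ := v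
  dsimp only at *
  refine existsUnique_of_exists_of_unique ?_ ?_
  · have h : ((j : ℤ) - 3 * i - 2 - c) % 5 = 0 ∨ ((j : ℤ) - 3 * i - 2 - c) % 5 = 1 ∨
        ((j : ℤ) - 3 * i - 2 - c) % 5 = 2 ∨ ((j : ℤ) - 3 * i - 2 - c) % 5 = 3 ∨
        ((j : ℤ) - 3 * i - 2 - c) % 5 = 4 := by omega
    rcases h with h | h | h | h | h
    · exact ⟨(⟨i, hi⟩, ⟨j, hj⟩), by dsimp only; omega, by dsimp only; omega⟩
    · exact ⟨(⟨i, hi⟩, ⟨j - 1, by omega⟩), by dsimp only; omega, by dsimp only; omega⟩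
    · exact ⟨(⟨i - 1, by omega⟩, ⟨j, hj⟩), by dsimp only; omega, by dsimp only; omega⟩
    · exact ⟨(⟨i + 1, by omega⟩, ⟨j, hj⟩), by dsimp only; omega, by dsimp only; omega⟩
    · exact ⟨(⟨i, hi⟩, ⟨j + 1, by omega⟩), by dsimp only; omega, by dsimp only; omega⟩
  · rintro ⟨⟨a, ha⟩, ⟨b, hb⟩⟩ ⟨⟨a', ha'⟩, ⟨b', hb'⟩⟩ ⟨h, hn⟩ ⟨h', hn'⟩
    simp only [Prod.mk.injEq, Fin.mk.injEq] at *
    omega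
end
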